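/- arXiv:1203.3235 — 6 statements merged into one kernel-verified Lean document; each statement's English description precedes it below -/
import Mathlib

section
/- Let c > 0 and let F be a holomorphic function on the open unit disk 𝔻 ⊂ ℂ such that Re F(z) ∈ [0, c] for all z ∈ 𝔻. Then there exists a measurable function φ : [−π, π] → ℝ with 0 ≤ φ(θ) ≤ c for almost every θ, φ ∈ L¹([−π,π]), such that F(z) = i·Im F(0) + (1/2π) ∫_{−π}^{π} ((e^{iθ} + z)/(e^{iθ} − z)) φ(θ) dθ for all z ∈ 𝔻. -/
open MeasureTheory Set Complex Real

open Filter Topology in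
/-- Weak-* compactness of order intervals: a sequence of measurable functions with values in
`[a, b]` on a finite measure space has a weak `L²` cluster point with values in `[a, b]`. -/
theorem exists_mapClusterPt_integral_mul_of_mem_Icc {α : Type*} [MeasurableSpace α]
    {μ : Measure α} [IsFiniteMeasure μ] {a b : ℝ} (hab : a ≤ b) {u : ℕ → α → ℝ}
    (hu : ∀ n, Measurable (u n)) (hmem : ∀ n x, u n x ∈ Icc a b) :
    ∃ φ : α → ℝ, Measurable φ ∧ (∀ x, φ x ∈ Icc a b) ∧ ∀ k : α → ℝ, MemLp k 2 μ →
      MapClusterPt (∫ x, k x * φ x ∂μ) atTop (fun n ↦ ∫ x, k x * u n x ∂μ) := by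
  have hbound : ∀ n x, ‖u n x‖ ≤ max |a| |b| := fun n x ↦
    abs_le_max_abs_abs (hmem n x).1 (hmem n x).2
  have huLp : ∀ n, MemLp (u n) 2 μ := fun n ↦
    .of_bound (hu n).aestronglyMeasurable _ (.of_forall (hbound n))
  set v : ℕ → Lp ℝ 2 μ := fun n ↦ (huLp n).toLp
  obtain ⟨C, hC⟩ : ∃ C, ∀ n, ‖v n‖ ≤ C := ⟨_, fun n ↦ Lp.norm_le_of_ae_bound
    ((abs_nonneg a).trans (le_max_left _ |b|))
    ((huLp n).coeFn_toLp.mono fun x hx ↦ hx ▸ hbound n x)⟩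
  obtain ⟨Λ, -, hΛ⟩ := (WeakDual.isCompact_closedBall (𝕜 := ℝ) (E := Lp ℝ 2 μ) 0 C)
    |>.exists_mapClusterPt (f := atTop) (u := fun n : ℕ ↦
      StrongDual.toWeakDual (InnerProductSpace.toDual ℝ (Lp ℝ 2 μ) (v n)))
    (le_principal_iff.2 <| mem_map.2 <| Eventually.of_forall fun n ↦ by simpa using hC n)
  set f : Lp ℝ 2 μ := (InnerProductSpace.toDual ℝ (Lp ℝ 2 μ)).symm (WeakDual.toStrongDual Λ)
  have key : ∀ k : α → ℝ, MemLp k 2 μ →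
      MapClusterPt (∫ x, k x * f x ∂μ) atTop (fun n ↦ ∫ x, k x * u n x ∂μ) := by
    intro k hk
    have h := hΛ.continuousAt_comp (WeakDual.eval_continuous hk.toLp).continuousAt
    convert h using 1
    · trans inner ℝ f hk.toLp
      · rw [L2.inner_def]
        refine integral_congr_ae (hk.coeFn_toLp.mono fun x hx ↦ ?_)
        simp [hx]
      · simp [f]
    · ext n
      trans inner ℝ (v n) hk.toLp
      · rw [L2.inner_def]
        refine integral_congr_ae ?_
        filter_upwards [hk.coeFn_toLp, (huLp n).coeFn_toLp] with x hx hx'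
        simp [v, hx, hx']
      · simp [v]
  have hfi : Integrable f μ := (Lp.memLp f).integrable (by norm_num)
  have hset : ∀ s, MeasurableSet s →
      MapClusterPt (∫ x in s, f x ∂μ) atTop (fun n ↦ ∫ x in s, u n x ∂μ) := by
    intro s hs
    have := key (s.indicator 1) (memLp_indicator_const 2 hs 1 (.inr (measure_ne_top _ _)))
    simpa [← indicator_mul_left, integral_indicator hs] using this
  have hui : ∀ n, Integrable (u n) μ := fun n ↦ (huLp n).integrable (by norm_num)
  have hlo : ∀ᵐ x ∂μ, a ≤ f x := ae_le_of_forall_setIntegral_le (integrable_const a) hfi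
    fun s hs _ ↦ isClosed_Ici.mem_of_mapClusterPt (hset s hs) <| .of_forall fun n ↦
      setIntegral_mono (integrable_const a).integrableOn (hui n).integrableOn fun x ↦ (hmem n x).1
  have hhi : ∀ᵐ x ∂μ, f x ≤ b := ae_le_of_forall_setIntegral_le hfi (integrable_const b)
    fun s hs _ ↦ isClosed_Iic.mem_of_mapClusterPt (hset s hs) <| .of_forall fun n ↦
      setIntegral_mono (hui n).integrableOn (integrable_const b).integrableOn fun x ↦ (hmem n x).2
  refine ⟨fun x ↦ projIcc a b hab (f x), ?_, fun x ↦ (projIcc a b hab (f x)).2, fun k hk ↦ ?_⟩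
  · exact (continuous_subtype_val.comp continuous_projIcc).measurable.comp
      (Lp.stronglyMeasurable f).measurable
  · convert key k hk using 1
    refine integral_congr_ae ?_
    filter_upwards [hlo, hhi] with x h₁ h₂
    simp [projIcc_of_mem hab ⟨h₁, h₂⟩]

/-- The average over the unit circle as an integral over `(-π, π]`. -/
theorem circleAverage_zero_one_eq_integral_neg_pi_pi {E : Type*} [NormedAddCommGroup E]
    [NormedSpace ℝ E] (f : ℂ → E) :
    circleAverage f 0 1 = (2 * π)⁻¹ • ∫ θ in (-π)..π, f (cexp (θ * I)) := by
  have hper : (fun θ ↦ f (circleMap 0 1 θ)).Periodic (2 * π) := fun θ ↦ by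
    simp only [periodic_circleMap 0 1 θ]
  have := hper.intervalIntegral_add_eq 0 (-π)
  rw [circleAverage_def]
  rw [zero_add, show -π + 2 * π = π by ring] at this
  rw [this]
  simp [circleMap]

theorem arg_exp_ofReal_mul_I {θ : ℝ} (hθ : θ ∈ Ioc (-π) π) : arg (cexp (θ * I)) = θ := by
  rw [exp_mul_I, arg_cos_add_sin_mul_I hθ]

open Filter Topology Metric in
/-- The real part of a holomorphic function on the unit disk, if bounded, is the Poisson integral
of a bounded measurable function of the argument. -/
theorem exists_re_eq_circleAverage_herglotzRieszKernel {a b : ℝ} (hab : a ≤ b) {F : ℂ → ℂ}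
    (hF : DifferentiableOn ℂ F (ball 0 1)) (hRe : ∀ z ∈ ball (0 : ℂ) 1, (F z).re ∈ Icc a b) :
    ∃ φ : ℝ → ℝ, Measurable φ ∧ (∀ θ, φ θ ∈ Icc a b) ∧ ∀ z ∈ ball (0 : ℂ) 1,
      circleAverage ((re ∘ herglotzRieszKernel 0 z) • (φ ∘ arg)) 0 1 = (F z).re := by
  have hpi : -π ≤ π := by linarith [pi_pos]
  obtain ⟨r, -, hr, hr1⟩ := exists_seq_strictMono_tendsto' (zero_lt_one (α := ℝ))
  have hmaps : ∀ n, ∀ z ∈ closedBall (0 : ℂ) 1, (r n : ℂ) * z ∈ ball (0 : ℂ) 1 := by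
    intro n z hz
    rw [mem_closedBall_zero_iff] at hz
    rw [mem_ball_zero_iff, norm_mul, norm_real, Real.norm_of_nonneg (hr n).1.le]
    nlinarith [(hr n).1, (hr n).2, norm_nonneg z]
  have hexp : ∀ θ : ℝ, cexp (θ * I) ∈ closedBall (0 : ℂ) 1 := by simp
  obtain ⟨φ, hφ, hφmem, hcl⟩ := exists_mapClusterPt_integral_mul_of_mem_Icc hab
    (μ := volume.restrict (Ioc (-π) π)) (u := fun n θ ↦ (F (r n * cexp (θ * I))).re)
    (fun n ↦ by
      refine (continuous_re.comp (hF.continuousOn.comp_continuous (by fun_prop)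
        fun θ ↦ hmaps n _ (hexp θ))).measurable)
    (fun n θ ↦ hRe _ (hmaps n _ (hexp θ)))
  refine ⟨φ, hφ, hφmem, fun z hz ↦ ?_⟩
  have hk : Continuous fun θ : ℝ ↦ (herglotzRieszKernel 0 z (cexp (θ * I))).re := by
    refine continuous_re.comp <|
      (continuousOn_herglotzRieszKernel_sphere (R := 1) hz).comp_continuous (by fun_prop) ?_
    simp
  have hkLp : MemLp (fun θ : ℝ ↦ (herglotzRieszKernel 0 z (cexp (θ * I))).re) 2
      (volume.restrict (Ioc (-π) π)) := by
    obtain ⟨C, hC⟩ := isCompact_Icc.exists_bound_of_continuousOn (hk.continuousOn (s := Icc (-π) π))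
    exact .of_bound hk.aestronglyMeasurable C <|
      ae_restrict_of_forall_mem measurableSet_Ioc fun θ hθ ↦ hC θ (Ioc_subset_Icc_self hθ)
  have hpoisson : ∀ n, ∫ θ in Ioc (-π) π, (herglotzRieszKernel 0 z (cexp (θ * I))).re *
      (F (r n * cexp (θ * I))).re = 2 * π * (F (r n * z)).re := by
    intro n
    have hd : DifferentiableOn ℂ (fun w ↦ F (r n * w)) (closedBall 0 1) :=
      hF.comp (by fun_prop) (hmaps n)
    have hdc : DiffContOnCl ℂ (fun w ↦ F (r n * w)) (ball 0 1) :=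
      DifferentiableOn.diffContOnCl (by rwa [closure_ball _ one_ne_zero])
    have hci : CircleIntegrable ((re ∘ herglotzRieszKernel 0 z) • fun w ↦ F (r n * w)) 0 1 := by
      refine ContinuousOn.circleIntegrable zero_le_one (ContinuousOn.smul ?_ ?_)
      · have := continuousOn_herglotzRieszKernel_sphere (R := 1) hz
        rw [abs_one] at this
        exact continuous_re.comp_continuousOn this
      · exact hd.continuousOn.mono sphere_subset_closedBall
    have h := reCLM.circleAverage_comp_comm hci
    rw [hdc.circleAverage_re_herglotzRieszKernel_smul hz,
      circleAverage_zero_one_eq_integral_neg_pi_pi, inv_smul_eq_iff₀ (by positivity),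
      intervalIntegral.integral_of_le hpi] at h
    simpa using h
  have hlim : Tendsto (fun n ↦ 2 * π * (F (r n * z)).re) atTop (𝓝 (2 * π * (F z).re)) := by
    have hrz : Tendsto (fun n ↦ (r n : ℂ) * z) atTop (𝓝 z) := by
      simpa using ((continuous_ofReal.tendsto 1).comp hr1).mul_const z
    exact ((continuous_re.tendsto _).comp <|
      (hF.continuousOn.continuousAt (isOpen_ball.mem_nhds hz)).tendsto.comp hrz).const_mul _
  have hcl' := hcl _ hkLp
  simp only [hpoisson] at hcl'
  have : NeBot (𝓝 _ ⊓ 𝓝 _) := hcl'.clusterPt.mono hlim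
  rw [circleAverage_zero_one_eq_integral_neg_pi_pi, inv_smul_eq_iff₀ (by positivity),
    smul_eq_mul (2 * π), ← eq_of_nhds_neBot this, intervalIntegral.integral_of_le hpi]
  refine setIntegral_congr_fun measurableSet_Ioc fun θ hθ ↦ ?_
  simp [arg_exp_ofReal_mul_I hθ]

/-- Riesz–Herglotz representation for holomorphic functions on the unit disk
whose real part takes values in `[0, c]`. -/
theorem stmt_1 (c : ℝ) (hc : 0 < c) (F : ℂ → ℂ)
    (hF : DifferentiableOn ℂ F (Metric.ball (0 : ℂ) 1))
    (hRe : ∀ z ∈ Metric.ball (0 : ℂ) 1, (F z).re ∈ Icc 0 c) :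
    ∃ φ : ℝ → ℝ, Measurable φ ∧
      IntegrableOn φ (Icc (-π) π) ∧
      (∀ᵐ θ ∂(volume.restrict (Icc (-π) π)), φ θ ∈ Icc 0 c) ∧
      (∀ z ∈ Metric.ball (0 : ℂ) 1,
        F z = Complex.I * ((F 0).im : ℂ) +
          (1 / (2 * π) : ℂ) * ∫ θ in (-π)..π,
            ((Complex.exp (θ * Complex.I) + z) /
              (Complex.exp (θ * Complex.I) - z)) * (φ θ : ℂ)) := by
  obtain ⟨φ, hφ, hφmem, hφF⟩ := exists_re_eq_circleAverage_herglotzRieszKernel hc.le hF hRe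
  have hbound : ∀ θ, ‖φ θ‖ ≤ c := fun θ ↦ by
    rw [Real.norm_of_nonneg (hφmem θ).1]; exact (hφmem θ).2
  have hci : CircleIntegrable (φ ∘ arg) 0 1 := by
    rw [CircleIntegrable, intervalIntegrable_iff]
    exact Measure.integrableOn_of_bounded measure_Ioc_lt_top.ne
      (by fun_prop : Measurable fun θ ↦ (φ ∘ arg) (circleMap 0 1 θ)).aestronglyMeasurable
      (.of_forall fun θ ↦ hbound _)
  have hciC : CircleIntegrable (fun ζ ↦ ((φ ∘ arg) ζ : ℂ)) 0 1 := by
    simp only [CircleIntegrable, intervalIntegrable_iff] at hci ⊢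
    exact ofRealCLM.integrable_comp hci
  set G : ℂ → ℂ := fun z ↦
    circleAverage (fun ζ ↦ herglotzRieszKernel 0 z ζ • ((φ ∘ arg) ζ : ℂ)) 0 1
  have hG : AnalyticOnNhd ℂ G (Metric.ball 0 1) :=
    analyticOnNhd_circleAverage_herglotzRieszKernel_smul hciC
  have hGint : ∀ z, G z = (1 / (2 * π) : ℂ) * ∫ θ in (-π)..π,
      ((cexp (θ * I) + z) / (cexp (θ * I) - z)) * (φ θ : ℂ) := by
    intro z
    simp only [G]
    rw [circleAverage_zero_one_eq_integral_neg_pi_pi, real_smul]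
    push_cast
    rw [one_div]
    congr 1
    refine intervalIntegral.integral_congr_ae (.of_forall fun θ hθ ↦ ?_)
    rw [uIoc_of_le (by linarith [pi_pos])] at hθ
    simp [herglotzRieszKernel_def, arg_exp_ofReal_mul_I hθ]
  have hG0 : (G 0).im = 0 := by
    rw [hGint]
    simp [intervalIntegral.integral_ofReal]
  obtain ⟨k, hk⟩ := ((hF.analyticOnNhd Metric.isOpen_ball).sub hG)
    |>.eq_re_add_const_mul_I_of_re_eq_const
    (c₀ := 0) (fun z hz ↦ by
      rw [Pi.sub_apply, sub_re, re_circleAverage_herglotzRieszKernel_smul hci hz, hφF z hz,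
        sub_self])
    Metric.isOpen_ball ((convex_ball _ _).isConnected ⟨0, by simp⟩)
  have hk0 : k = (F 0).im := by
    simpa [hG0] using (congrArg im (hk 0 (by simp))).symm
  refine ⟨φ, hφ, ?_, .of_forall hφmem, fun z hz ↦ ?_⟩
  · exact Measure.integrableOn_of_bounded (by simp) hφ.aestronglyMeasurable (.of_forall hbound)
  · have := hk z hz
    rw [hk0, Pi.sub_apply, sub_eq_iff_eq_add] at this
    rw [← hGint, this]
    simp [mul_comm]
end

section
/- Let n ≥ 1 and let P(x) = σ_0 + σ_1 x + … + σ_n x^n be a real polynomial with σ_n < 0, and let γ_k = ∫_0^∞ x^k e^{P(x)} dx for k ≥ 0 (these are strictly positive real numbers). Then the Carleman series diverges: Σ_{m=1}^∞ γ_m^{−1/m} = ∞. -/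
open MeasureTheory Set Real

/-- A real polynomial function with negative leading coefficient is bounded above on `[0, ∞)` by a
decreasing affine function. -/
theorem exists_affine_bound (n : ℕ) (hn : 1 ≤ n) (σ : Fin (n + 1) → ℝ) (hσ : σ (Fin.last n) < 0) :
    ∃ C c : ℝ, 0 < c ∧
      ∀ x : ℝ, 0 ≤ x → ∑ i : Fin (n + 1), σ i * x ^ (i : ℕ) ≤ C - c * x := by
  obtain ⟨k, rfl⟩ : ∃ k, n = k + 1 := ⟨n - 1, by lia⟩
  set a := -σ (Fin.last (k + 1)) with ha
  have ha0 : 0 < a := by linarith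
  set S := ∑ i : Fin (k + 1), |σ i.castSucc| with hS
  set R := max 1 (2 * S / a)
  have large (x : ℝ) (hx : R ≤ x) :
      ∑ i : Fin (k + 1 + 1), σ i * x ^ (i : ℕ) ≤ -(a / 2 * x) := by
    have hx1 : 1 ≤ x := (le_max_left _ _).trans hx
    have hxS : 2 * S ≤ x * a := (div_le_iff₀ ha0).1 ((le_max_right _ _).trans hx)
    have hlow : ∑ i : Fin (k + 1), σ i.castSucc * x ^ (i : ℕ) ≤ S * x ^ k := by
      rw [hS, Finset.sum_mul]
      refine Finset.sum_le_sum fun i _ => ?_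
      have hi : (i : ℕ) ≤ k := by lia
      gcongr
      exact le_abs_self _
    have hk : 1 ≤ x ^ k := one_le_pow₀ hx1
    have hlead : σ (Fin.last (k + 1)) = -a := by simp [ha]
    rw [Fin.sum_univ_castSucc]
    simp only [Fin.val_castSucc, Fin.val_last, hlead, pow_succ]
    nlinarith [mul_le_mul_of_nonneg_right hxS (zero_le_one.trans hk),
      mul_le_mul_of_nonneg_left hk (show 0 ≤ a * x by positivity)]
  have hcont : Continuous fun x : ℝ =>
      (∑ i : Fin (k + 1 + 1), σ i * x ^ (i : ℕ)) + a / 2 * x := by fun_prop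
  obtain ⟨M, hM⟩ := (isCompact_Icc (a := (0 : ℝ)) (b := R)).bddAbove_image hcont.continuousOn
  refine ⟨max M 0, a / 2, by positivity, fun x hx => ?_⟩
  rcases le_total x R with h | h
  · have : (∑ i : Fin (k + 1 + 1), σ i * x ^ (i : ℕ)) + a / 2 * x ≤ M :=
      hM (mem_image_of_mem _ ⟨hx, h⟩)
    have := le_max_left M 0
    linarith
  · have := large x h
    have := le_max_right M 0
    linarith

theorem integral_pow_mul_exp_neg_mul (k : ℕ) {c : ℝ} (hc : 0 < c) :
    ∫ x in Ioi (0 : ℝ), x ^ k * Real.exp (-(c * x)) = (1 / c) ^ (k + 1) * (k.factorial : ℝ) := by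
  have h := Real.integral_rpow_mul_exp_neg_mul_Ioi (a := k + 1) (by positivity) hc
  rw [Real.Gamma_nat_eq_factorial, ← Nat.cast_succ, Real.rpow_natCast] at h
  simpa using h

theorem integrableOn_pow_mul_exp_neg_mul (k : ℕ) {c : ℝ} (hc : 0 < c) :
    IntegrableOn (fun x : ℝ => x ^ k * Real.exp (-(c * x))) (Ioi 0) := by
  have h := integrableOn_rpow_mul_exp_neg_mul_rpow (s := k) (p := 1)
    (by linarith [k.cast_nonneg (α := ℝ)]) one_pos hc
  simpa using h

/-- Carleman's series diverges for a positive sequence with at most factorial growth. -/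
theorem carleman_series_eq_top {γ : ℕ → ℝ} {B b : ℝ} (hb : 0 < b) (hγ : ∀ k, 0 < γ k)
    (hγB : ∀ k, γ k ≤ B * b ^ k * (k.factorial : ℝ)) :
    (∑' m : ℕ, ENNReal.ofReal (γ (m + 1) ^ (-(1 : ℝ) / (m + 1 : ℝ)))) = ⊤ := by
  set D := max B 1
  have hD : 1 ≤ D := le_max_right _ _
  have hterm (m : ℕ) :
      (D * b)⁻¹ * (1 / (m + 1 : ℕ)) ≤ γ (m + 1) ^ (-(1 : ℝ) / (m + 1 : ℝ)) := by
    have hle : γ (m + 1) ≤ (D * b * (m + 1 : ℕ)) ^ (m + 1) := by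
      calc γ (m + 1) ≤ B * b ^ (m + 1) * ((m + 1).factorial : ℝ) := hγB _
        _ ≤ D ^ (m + 1) * b ^ (m + 1) * ((m + 1 : ℕ) : ℝ) ^ (m + 1) := by
          gcongr
          · exact (le_max_left _ _).trans (le_self_pow₀ hD m.succ_ne_zero)
          · exact_mod_cast Nat.factorial_le_pow (m + 1)
        _ = _ := by rw [mul_pow, mul_pow]
    have hroot := Real.rpow_le_rpow (hγ _).le hle (by positivity : (0 : ℝ) ≤ ((m + 1 : ℕ) : ℝ)⁻¹)
    rw [Real.pow_rpow_inv_natCast (by positivity) m.succ_ne_zero] at hroot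
    rw [one_div, ← mul_inv, neg_div, Real.rpow_neg (hγ _).le, one_div, ← Nat.cast_succ]
    exact inv_anti₀ (Real.rpow_pos_of_pos (hγ _) _) hroot
  by_contra h
  have hs := ENNReal.summable_toReal h
  simp only [ENNReal.toReal_ofReal (Real.rpow_nonneg (hγ _).le _)] at hs
  have hs' := Summable.of_nonneg_of_le (fun m => by positivity) hterm hs
  rw [summable_mul_left_iff (by positivity)] at hs'
  exact Real.not_summable_one_div_natCast
    ((summable_nat_add_iff (f := fun m : ℕ => 1 / (m : ℝ)) 1).1 hs')

/-- The Carleman series of the moments of an exponential density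
`e^{P(x)} dx` on `[0, ∞)` diverges: `Σ_{m ≥ 1} γ_m^{-1/m} = ∞`
(the moments are strictly positive real numbers). -/
theorem stmt_4 (n : ℕ) (hn : 1 ≤ n) (σ : Fin (n + 1) → ℝ)
    (hσ : σ ⟨n, Nat.lt_succ_self n⟩ < 0)
    (P : ℝ → ℝ) (hP : ∀ x, P x = ∑ i : Fin (n + 1), σ i * x ^ (i : ℕ))
    (γ : ℕ → ℝ) (hγ : ∀ k, γ k = ∫ x in Ioi (0 : ℝ), x ^ k * Real.exp (P x)) :
    (∀ k, 0 < γ k) ∧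
    (∑' m : ℕ, ENNReal.ofReal (γ (m + 1) ^ (-(1 : ℝ) / (m + 1 : ℝ)))) = ⊤ := by
  obtain ⟨C, c, hc, hbound⟩ := exists_affine_bound n hn σ hσ
  have hPcont : Continuous P := by
    rw [funext hP]
    fun_prop
  have hle (k : ℕ) : ∀ x ∈ Ioi (0 : ℝ),
      x ^ k * Real.exp (P x) ≤ Real.exp C * (x ^ k * Real.exp (-(c * x))) := by
    intro x hx
    have hx0 : 0 ≤ x := le_of_lt hx
    calc x ^ k * Real.exp (P x) ≤ x ^ k * Real.exp (C - c * x) := by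
          gcongr
          exact hP x ▸ hbound x hx0
      _ = _ := by rw [sub_eq_add_neg, Real.exp_add]; ring
  have hdom (k : ℕ) := (integrableOn_pow_mul_exp_neg_mul k hc).const_mul (Real.exp C)
  have hint (k : ℕ) : IntegrableOn (fun x => x ^ k * Real.exp (P x)) (Ioi 0) := by
    refine (hdom k).mono' (by fun_prop) ?_
    filter_upwards [ae_restrict_mem measurableSet_Ioi] with x hx
    have hx0 : 0 < x := hx
    rw [Real.norm_of_nonneg (by positivity)]
    exact hle k x hx
  have hpos (k : ℕ) : 0 < γ k := by
    rw [hγ, setIntegral_pos_iff_support_of_nonneg_ae _ (hint k)]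
    · have hsub : Ioi (0 : ℝ) ⊆ Function.support fun x => x ^ k * Real.exp (P x) := by
        intro x hx
        have hx0 : 0 < x := hx
        exact ne_of_gt (by positivity)
      rw [inter_eq_right.2 hsub]
      simp
    · filter_upwards [ae_restrict_mem measurableSet_Ioi] with x hx
      have hx0 : 0 < x := hx
      simp only [Pi.zero_apply]
      positivity
  refine ⟨hpos, carleman_series_eq_top (B := Real.exp C * (1 / c)) (one_div_pos.2 hc) hpos
    fun k => ?_⟩
  calc γ k ≤ ∫ x in Ioi (0 : ℝ), Real.exp C * (x ^ k * Real.exp (-(c * x))) := by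
        rw [hγ]
        exact setIntegral_mono_on (hint k) (hdom k) measurableSet_Ioi (hle k)
    _ = _ := by
        rw [integral_const_mul, integral_pow_mul_exp_neg_mul k hc]
        ring
end

section
/- Let P be a non-constant real polynomial with negative leading coefficient. If μ is a positive Borel measure on [0,∞) with finite moments of all orders such that ∫_{[0,∞)} x^k dμ(x) = ∫_0^∞ x^k e^{P(x)} dx for every integer k ≥ 0, then μ equals the measure with density e^{P(x)} with respect to Lebesgue measure on [0,∞). In other words, the Stieltjes moment problem with density e^{P} dx is determinate. -/
open MeasureTheory Set Real Polynomial

open Filter in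
/-- A non-constant polynomial with negative leading coefficient is eventually bounded above by a
linear function of negative slope. -/
lemma Polynomial.exists_eventually_eval_le_neg_mul (P : Polynomial ℝ) (hdeg : 0 < P.degree)
    (hlead : P.leadingCoeff < 0) :
    ∃ b > 0, ∀ᶠ x in atTop, P.eval x ≤ -b * x := by
  refine ⟨-P.leadingCoeff / 2, by linarith, ?_⟩
  have h := P.isEquivalent_atTop_lead.isLittleO.bound (c := 1 / 2) (by norm_num)
  filter_upwards [h, eventually_ge_atTop 1] with x hx h1
  have hn : P.natDegree ≠ 0 := (natDegree_pos_iff_degree_pos.2 hdeg).ne'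
  have hpow : x ≤ x ^ P.natDegree := le_self_pow₀ h1 hn
  have hneg : P.leadingCoeff * x ^ P.natDegree < 0 :=
    mul_neg_of_neg_of_pos hlead (by positivity)
  simp only [Pi.sub_apply, Real.norm_eq_abs, abs_of_neg hneg] at hx
  have := (abs_le.1 hx).2
  nlinarith

section Stieltjes

open ProbabilityTheory Filter Topology

variable {μ ν : Measure ℝ}

/-- For a measure on `[0, ∞)` with finite moments, the exponential integral is the sum of the
scaled moments. -/
lemma lintegral_exp_mul_eq_tsum_moments (hμ : μ (Iio 0) = 0)
    (hint : ∀ k : ℕ, Integrable (fun x : ℝ ↦ x ^ k) μ) {t : ℝ} (ht : 0 ≤ t) :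
    ∫⁻ x, ENNReal.ofReal (exp (t * x)) ∂μ =
      ∑' k : ℕ, ENNReal.ofReal (t ^ k / k.factorial * ∫ x, x ^ k ∂μ) := by
  have hnn : ∀ᵐ x ∂μ, 0 ≤ x := by
    rw [ae_iff]; simpa [Iio_def] using hμ
  calc ∫⁻ x, ENNReal.ofReal (exp (t * x)) ∂μ
      = ∫⁻ x, ∑' k : ℕ, ENNReal.ofReal (t ^ k / k.factorial * x ^ k) ∂μ := by
        refine lintegral_congr_ae (hnn.mono fun x hx ↦ ?_)
        have hs : HasSum (fun k : ℕ ↦ t ^ k / k.factorial * x ^ k) (exp (t * x)) := by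
          rw [Real.exp_eq_exp_ℝ]
          simpa only [mul_pow, div_mul_eq_mul_div] using NormedSpace.expSeries_div_hasSum_exp (t * x)
        change ENNReal.ofReal _ = _
        rw [← hs.tsum_eq]
        exact ENNReal.ofReal_tsum_of_nonneg (fun k ↦ by positivity) hs.summable
    _ = ∑' k : ℕ, ∫⁻ x, ENNReal.ofReal (t ^ k / k.factorial * x ^ k) ∂μ :=
        lintegral_tsum fun k ↦ by fun_prop
    _ = _ := by
        refine tsum_congr fun k ↦ ?_
        rw [← integral_const_mul, ofReal_integral_eq_lintegral_ofReal ((hint k).const_mul _)]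
        exact hnn.mono fun x hx ↦ by positivity

/-- A finite measure on `[0, ∞)` with a finite exponential moment has finite exponential moments
of all smaller orders. -/
lemma Iic_subset_integrableExpSet_of_nonneg [IsFiniteMeasure μ] (hμ : μ (Iio 0) = 0) {c : ℝ}
    (hc : c ∈ integrableExpSet id μ) : Iic c ⊆ integrableExpSet id μ := by
  intro t ht
  have hnn : ∀ᵐ x ∂μ, 0 ≤ x := by
    rw [ae_iff]; simpa [Iio_def] using hμ
  refine Integrable.mono' (g := fun x ↦ exp (c * id x)) hc (by fun_prop)
    (hnn.mono fun x hx ↦ ?_)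
  rw [Real.norm_eq_abs, abs_exp]
  exact exp_le_exp.2 (mul_le_mul_of_nonneg_right ht hx)

/-- A finite measure on `[0, ∞)` with a finite exponential moment is determined by its moments
among the measures on `[0, ∞)`. -/
theorem MeasureTheory.Measure.ext_of_moments_of_integrable_exp [IsFiniteMeasure μ]
    [IsFiniteMeasure ν] (hμ : μ (Iio 0) = 0) (hν : ν (Iio 0) = 0)
    (hint : ∀ k : ℕ, Integrable (fun x : ℝ ↦ x ^ k) μ)
    {c : ℝ} (hc : 0 < c) (hexp : Integrable (fun x ↦ exp (c * x)) ν)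
    (hmom : ∀ k : ℕ, ∫ x, x ^ k ∂μ = ∫ x, x ^ k ∂ν) : μ = ν := by
  have hsubν : Iic c ⊆ integrableExpSet id ν := Iic_subset_integrableExpSet_of_nonneg hν hexp
  have hIio {ρ : Measure ℝ} (h : Iic c ⊆ integrableExpSet id ρ) :
      Iio c ⊆ interior (integrableExpSet id ρ) :=
    (interior_Iic (a := c)).symm.subset.trans (interior_mono h)
  have hintν (k : ℕ) : Integrable (fun x : ℝ ↦ x ^ k) ν :=
    integrable_pow_of_mem_interior_integrableExpSet (X := id) (hIio hsubν hc) k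
  have hlint {t : ℝ} (ht : 0 ≤ t) :
      ∫⁻ x, ENNReal.ofReal (exp (t * x)) ∂μ = ∫⁻ x, ENNReal.ofReal (exp (t * x)) ∂ν := by
    simp_rw [lintegral_exp_mul_eq_tsum_moments hμ hint ht,
      lintegral_exp_mul_eq_tsum_moments hν hintν ht, hmom]
  have hsubμ : Iic c ⊆ integrableExpSet id μ := by
    refine Iic_subset_integrableExpSet_of_nonneg hμ ?_
    refine (lintegral_ofReal_ne_top_iff_integrable (by fun_prop)
      (ae_of_all _ fun x ↦ (exp_pos _).le)).1 ?_
    simp only [id]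
    rw [hlint hc.le]
    exact (lintegral_ofReal_ne_top_iff_integrable (by fun_prop)
      (ae_of_all _ fun x ↦ (exp_pos _).le)).2 hexp
  have hmgf {t : ℝ} (ht : 0 ≤ t) : mgf id μ t = mgf id ν t := by
    simp only [mgf, id]
    rw [integral_eq_lintegral_of_nonneg_ae (ae_of_all _ fun x ↦ (exp_pos _).le) (by fun_prop),
      integral_eq_lintegral_of_nonneg_ae (ae_of_all _ fun x ↦ (exp_pos _).le) (by fun_prop),
      hlint ht]
  have hana {ρ : Measure ℝ} (h : Iic c ⊆ integrableExpSet id ρ) :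
      AnalyticOnNhd ℂ (complexMGF id ρ) {z | z.re < c} :=
    analyticOnNhd_complexMGF.mono fun z hz ↦ hIio h hz
  have heqOn : EqOn (complexMGF id μ) (complexMGF id ν) {z : ℂ | z.re < c} := by
    refine (hana hsubμ).eqOn_of_preconnected_of_frequently_eq (hana hsubν)
      (convex_halfSpace_re_lt c).isPreconnected (z₀ := ((c / 2 : ℝ) : ℂ))
      (by simpa using half_lt_self hc) ?_
    have hreal : ∃ᶠ t : ℝ in 𝓝[≠] (c / 2), complexMGF id μ t = complexMGF id ν t := by
      refine Eventually.frequently ?_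
      filter_upwards [mem_nhdsWithin_of_mem_nhds (Ioi_mem_nhds (half_pos hc))] with t ht
      rw [complexMGF_ofReal, complexMGF_ofReal, hmgf (le_of_lt ht)]
    refine Tendsto.frequently ?_ hreal
    exact tendsto_nhdsWithin_of_tendsto_nhds_of_eventually_within _
      (Complex.continuous_ofReal.tendsto _ |>.mono_left nhdsWithin_le_nhds)
      (eventually_nhdsWithin_of_forall fun t ht ↦ Complex.ofReal_injective.ne ht)
  refine Measure.ext_of_charFun (funext fun t ↦ ?_)
  rw [← complexMGF_id_mul_I, ← complexMGF_id_mul_I]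
  exact heqOn (by simpa using hc)

end Stieltjes

/-- The Stieltjes moment problem with density `e^{P(x)} dx` on `[0, ∞)`,
for a non-constant real polynomial `P` with negative leading coefficient,
is determinate: any positive Borel measure on `[0, ∞)` with finite moments
of all orders and the same moments equals that measure. -/
theorem stmt_5 (P : Polynomial ℝ) (hdeg : 0 < P.degree) (hlead : P.leadingCoeff < 0)
    (μ : Measure ℝ) [IsFiniteMeasure μ] (hsupp : μ (Iio (0 : ℝ)) = 0)
    (hmom : ∀ k : ℕ, Integrable (fun x : ℝ => x ^ k) μ)
    (heq : ∀ k : ℕ,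
      ∫ x : ℝ, x ^ k ∂μ = ∫ x in Ioi (0 : ℝ), x ^ k * Real.exp (P.eval x)) :
    μ = (volume.restrict (Ici (0 : ℝ))).withDensity
      (fun x : ℝ => ENNReal.ofReal (Real.exp (P.eval x))) := by
  obtain ⟨b, hb, hP⟩ := P.exists_eventually_eval_le_neg_mul hdeg hlead
  have hint {t : ℝ} (ht : t ≤ b / 2) :
      Integrable (fun x ↦ exp (t * x) * exp (P.eval x)) (volume.restrict (Ici (0 : ℝ))) := by
    rw [Measure.restrict_congr_set Ioi_ae_eq_Ici.symm]
    refine integrable_of_isBigO_exp_neg (half_pos hb) (by fun_prop) (.of_bound 1 ?_)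
    filter_upwards [hP, Filter.eventually_ge_atTop 0] with x hx h0
    rw [← exp_add, Real.norm_eq_abs, Real.norm_eq_abs, abs_exp, abs_exp, one_mul, exp_le_exp]
    nlinarith
  have hmeas : Measurable fun x : ℝ ↦ exp (P.eval x) := by fun_prop
  have hfin : IsFiniteMeasure ((volume.restrict (Ici (0 : ℝ))).withDensity
      (fun x : ℝ ↦ ENNReal.ofReal (exp (P.eval x)))) :=
    isFiniteMeasure_withDensity_ofReal
      (by simpa using (hint (t := 0) (half_pos hb).le).hasFiniteIntegral)
  refine Measure.ext_of_moments_of_integrable_exp hsupp ?_ hmom (half_pos hb) ?_ fun k ↦ ?_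
  · refine withDensity_absolutelyContinuous _ _ ?_
    rw [Measure.restrict_apply measurableSet_Iio, Iio_inter_Ici, Ico_self, measure_empty]
  · rw [integrable_withDensity_iff hmeas.ennreal_ofReal (by simp)]
    simpa only [ENNReal.toReal_ofReal (exp_pos _).le] using hint le_rfl
  · rw [heq k, integral_withDensity_eq_integral_toReal_smul hmeas.ennreal_ofReal (by simp),
      integral_Ici_eq_integral_Ioi]
    simp only [ENNReal.toReal_ofReal (exp_pos _).le, smul_eq_mul, mul_comm]
end

section
/- Let [a,b] be a bounded interval with a < b, let n ≥ 0, and let γ = (γ_0, …, γ_n) ∈ ℝ^{n+1} be such that Σ_{k=0}^n c_k γ_k > 0 for every nonzero polynomial f(x) = Σ_{k=0}^n c_k x^k that is non-negative on [a,b]. Then the functional L(λ) = Σ_{k=0}^n λ_k γ_k − ∫_a^b exp(λ_0 + λ_1 x + … + λ_n x^n) dx attains its supremum over ℝ^{n+1} at a unique point λ* ∈ ℝ^{n+1}, and the maximizer satisfies the moment-matching conditions γ_k = ∫_a^b x^k exp(λ*_0 + λ*_1 x + … + λ*_n x^n) dx for all 0 ≤ k ≤ n. -/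
open MeasureTheory Set Real

/-- The polynomial function `x ↦ ∑ c_k x^k` attached to a coefficient vector. -/
def coeffEval {m : ℕ} (c : Fin m → ℝ) (x : ℝ) : ℝ := ∑ k, c k * x ^ (k : ℕ)

section coeffEval

variable {m : ℕ}

lemma continuous_coeffEval_uncurry :
    Continuous (Function.uncurry (coeffEval : (Fin m → ℝ) → ℝ → ℝ)) := by
  unfold coeffEval Function.uncurry
  fun_prop

@[fun_prop]
lemma continuous_coeffEval (c : Fin m → ℝ) : Continuous (coeffEval c) := by
  unfold coeffEval
  fun_prop

lemma coeffEval_add (c d : Fin m → ℝ) (x : ℝ) :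
    coeffEval (c + d) x = coeffEval c x + coeffEval d x := by
  simp [coeffEval, add_mul, Finset.sum_add_distrib]

lemma coeffEval_smul (t : ℝ) (c : Fin m → ℝ) (x : ℝ) :
    coeffEval (t • c) x = t * coeffEval c x := by
  simp [coeffEval, Finset.mul_sum, mul_assoc]

lemma coeffEval_single (k : Fin m) (x : ℝ) : coeffEval (Pi.single k 1) x = x ^ (k : ℕ) := by
  simp [coeffEval, Pi.single_apply]

lemma eq_zero_of_coeffEval_eq_zero {c : Fin m → ℝ} {s : Set ℝ} (hs : s.Infinite)
    (h : ∀ x ∈ s, coeffEval c x = 0) : c = 0 := by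
  let p : Polynomial ℝ := ∑ k, Polynomial.C (c k) * Polynomial.X ^ (k : ℕ)
  have hp : p = 0 := by
    refine Polynomial.eq_zero_of_infinite_isRoot p (hs.mono fun x hx => ?_)
    simpa [p, Polynomial.IsRoot, Polynomial.eval_finsetSum, coeffEval] using h x hx
  ext k
  have hk : p.coeff k = c k := by
    simp [p, Polynomial.finsetSum_coeff, Polynomial.coeff_X_pow, Fin.val_inj]
  simpa [hp] using hk.symm

lemma eq_zero_of_coeffEval_eq_zero_on_Icc {a b : ℝ} (hab : a < b) {c : Fin m → ℝ}
    (h : ∀ x ∈ Icc a b, coeffEval c x = 0) : c = 0 :=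
  eq_zero_of_coeffEval_eq_zero (Icc_infinite hab) h

end coeffEval

lemma mul_max_zero_sub_le_exp {K : ℝ} (y : ℝ) :
    K * max y 0 - K ^ 2 / 2 ≤ exp y := by
  rcases le_total y 0 with hy | hy
  · rw [max_eq_right hy]
    nlinarith [exp_pos y, sq_nonneg K]
  · rw [max_eq_left hy]
    nlinarith [quadratic_le_exp_of_nonneg hy, sq_nonneg (y - K)]

/-- A nonnegative continuous function `A` dominates a continuous function `B` on a compact set,
up to a constant factor, once `B` is negative where `A` vanishes. -/
lemma IsCompact.exists_nat_mul_gt {X : Type*} [TopologicalSpace X] {s : Set X} (hs : IsCompact s)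
    {A B : X → ℝ} (hA : Continuous A) (hB : Continuous B) (hA0 : ∀ x, 0 ≤ A x)
    (hAB : ∀ x ∈ s, A x = 0 → B x < 0) : ∃ K : ℕ, ∀ x ∈ s, B x < K * A x := by
  have hmono : Monotone fun K : ℕ => {x | B x < K * A x} := by
    intro K K' hK x (hx : B x < K * A x)
    exact hx.trans_le (mul_le_mul_of_nonneg_right (Nat.cast_le.mpr hK) (hA0 x))
  refine hs.elim_directed_cover (fun K : ℕ => {x | B x < K * A x})
    (fun K => isOpen_lt hB (continuous_const.mul hA)) (fun x hx => ?_) hmono.directed_le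
  rw [mem_iUnion]
  rcases (hA0 x).eq_or_lt with h0 | h0
  · exact ⟨0, by simpa using hAB x hx h0.symm⟩
  · obtain ⟨K, hK⟩ := exists_nat_gt (B x / A x)
    exact ⟨K, (div_lt_iff₀ h0).mp hK⟩

/-- The negative of the entropy dual functional. -/
noncomputable def negEntropyDual (a b : ℝ) {m : ℕ} (γ c : Fin m → ℝ) : ℝ :=
  (∫ x in a..b, exp (coeffEval c x)) - ∑ k, c k * γ k

section negEntropyDual

variable {a b : ℝ} {m : ℕ} {γ : Fin m → ℝ}

lemma continuous_negEntropyDual : Continuous (negEntropyDual a b γ) := by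
  unfold negEntropyDual
  refine Continuous.sub ?_ (by fun_prop)
  exact intervalIntegral.continuous_parametric_intervalIntegral_of_continuous'
    (f := fun c x => exp (coeffEval c x)) (continuous_exp.comp continuous_coeffEval_uncurry) a b

lemma exists_norm_le_negEntropyDual (hab : a < b)
    (hγ : ∀ c : Fin m → ℝ, c ≠ 0 → (∀ x ∈ Icc a b, 0 ≤ coeffEval c x) → 0 < ∑ k, c k * γ k) :
    ∃ ε > 0, ∃ C, ∀ c, ε * ‖c‖ - C ≤ negEntropyDual a b γ c := by
  let A : (Fin m → ℝ) → ℝ := fun c => ∫ x in a..b, max (coeffEval c x) 0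
  let B : (Fin m → ℝ) → ℝ := fun c => ∑ k, c k * γ k
  have hA : Continuous A :=
    intervalIntegral.continuous_parametric_intervalIntegral_of_continuous'
      (continuous_coeffEval_uncurry.max continuous_const) a b
  have hB : Continuous B := by fun_prop
  have hA0 : ∀ c, 0 ≤ A c := fun c =>
    intervalIntegral.integral_nonneg hab.le fun x _ => le_max_right _ _
  have hAB : ∀ c ∈ Metric.sphere (0 : Fin m → ℝ) 1, A c = 0 → B c < 0 := by
    intro c hc hAc
    have hle : ∀ x ∈ Icc a b, coeffEval c x ≤ 0 := by
      by_contra! ⟨x, hx, hpos⟩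
      refine (intervalIntegral.integral_pos hab (f := fun x => max (coeffEval c x) 0)
        (by fun_prop) (fun _ _ => le_max_right _ _) ⟨x, hx, lt_max_of_lt_left hpos⟩).ne' hAc
    have hc0 : -c ≠ 0 := neg_ne_zero.mpr (ne_zero_of_mem_unit_sphere ⟨c, hc⟩)
    have := hγ (-c) hc0 fun x hx => by
      have := hle x hx
      rw [← neg_one_smul ℝ, coeffEval_smul]
      linarith
    simpa [B] using this
  obtain ⟨K, hK⟩ := (isCompact_sphere (0 : Fin m → ℝ) 1).exists_nat_mul_gt hA hB hA0 hAB
  obtain ⟨ε, hε, hεK⟩ : ∃ ε > 0, ∀ c ∈ Metric.sphere (0 : Fin m → ℝ) 1, ε ≤ K * A c - B c :=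
    (isCompact_sphere (0 : Fin m → ℝ) 1).exists_forall_le'
      ((continuous_const.mul hA).sub hB).continuousOn (a := 0) fun c hc => sub_pos.mpr (hK c hc)
  have hAsmul : ∀ t : ℝ, 0 ≤ t → ∀ c, A (t • c) = t * A c := by
    intro t ht c
    simp only [A, ← intervalIntegral.integral_const_mul]
    congr 1 with x
    rw [coeffEval_smul, mul_max_of_nonneg _ _ ht, mul_zero]
  have hBsmul : ∀ (t : ℝ) c, B (t • c) = t * B c := by
    intro t c
    simp [B, Finset.mul_sum, mul_assoc]
  have hlin : ∀ c, ε * ‖c‖ ≤ K * A c - B c := by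
    intro c
    rcases eq_or_ne c 0 with rfl | hc
    · have hA00 : A 0 = 0 := by simpa using hAsmul 0 le_rfl 0
      have hB00 : B 0 = 0 := by simp [B]
      simp [hA00, hB00]
    · have hn : ‖c‖ ≠ 0 := norm_ne_zero_iff.mpr hc
      have hu : ‖c‖⁻¹ • c ∈ Metric.sphere (0 : Fin m → ℝ) 1 := by
        simp [norm_smul, hn]
      have h := mul_le_mul_of_nonneg_right (hεK _ hu) (norm_nonneg c)
      rw [hAsmul _ (by positivity), hBsmul] at h
      refine h.trans_eq ?_
      field_simp
  refine ⟨ε, hε, (b - a) * (K ^ 2 / 2), fun c => ?_⟩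
  have hintegral : (K : ℝ) * A c - (b - a) * (K ^ 2 / 2) ≤ ∫ x in a..b, exp (coeffEval c x) := by
    have h := intervalIntegral.integral_mono_on (μ := volume) hab.le
      (f := fun x => (K : ℝ) * max (coeffEval c x) 0 - (K : ℝ) ^ 2 / 2)
      (g := fun x => exp (coeffEval c x))
      (Continuous.intervalIntegrable (by fun_prop) _ _)
      (Continuous.intervalIntegrable (by fun_prop) _ _)
      fun x _ => mul_max_zero_sub_le_exp _
    rwa [intervalIntegral.integral_sub (Continuous.intervalIntegrable (by fun_prop) _ _)
      (Continuous.intervalIntegrable (by fun_prop) _ _), intervalIntegral.integral_const_mul,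
      intervalIntegral.integral_const, smul_eq_mul] at h
  have := hlin c
  unfold negEntropyDual
  linarith

lemma exists_forall_negEntropyDual_le (hab : a < b)
    (hγ : ∀ c : Fin m → ℝ, c ≠ 0 → (∀ x ∈ Icc a b, 0 ≤ coeffEval c x) → 0 < ∑ k, c k * γ k) :
    ∃ c₀, ∀ c, negEntropyDual a b γ c₀ ≤ negEntropyDual a b γ c := by
  obtain ⟨ε, hε, C, h⟩ := exists_norm_le_negEntropyDual hab hγ
  refine continuous_negEntropyDual.exists_forall_le (Filter.tendsto_atTop_mono h ?_)
  exact Filter.tendsto_atTop_add_const_right _ _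
    (Filter.Tendsto.const_mul_atTop hε (tendsto_norm_cocompact_atTop (E := Fin m → ℝ)))

lemma hasDerivAt_integral_exp_add_mul {p q : ℝ → ℝ} (hp : Continuous p) (hq : Continuous q) :
    HasDerivAt (fun t : ℝ => ∫ x in a..b, exp (p x + t * q x))
      (∫ x in a..b, q x * exp (p x)) 0 := by
  have hbound := intervalIntegral.hasDerivAt_integral_of_dominated_loc_of_deriv_le
    (μ := volume) (a := a) (b := b) (x₀ := (0 : ℝ)) (s := Metric.ball 0 1)
    (F := fun t x => exp (p x + t * q x)) (F' := fun t x => q x * exp (p x + t * q x))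
    (bound := fun x => |q x| * exp (p x + |q x|))
    (Metric.ball_mem_nhds 0 one_pos)
    (.of_forall fun t => Continuous.aestronglyMeasurable (by fun_prop))
    (Continuous.intervalIntegrable (by fun_prop) _ _)
    (Continuous.aestronglyMeasurable (by fun_prop))
    (.of_forall fun x _ t ht => ?_)
    (Continuous.intervalIntegrable (by fun_prop) _ _)
    (.of_forall fun x _ t _ => ?_)
  · simpa using hbound.2
  · rw [norm_mul, norm_eq_abs, norm_eq_abs, abs_exp]
    gcongr
    rw [mem_ball_zero_iff, norm_eq_abs] at ht
    calc t * q x ≤ |t| * |q x| := by rw [← abs_mul]; exact le_abs_self _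
      _ ≤ |q x| := mul_le_of_le_one_left (abs_nonneg _) ht.le
  · have := (((hasDerivAt_id t).mul_const (q x)).const_add (p x)).exp
    simpa [mul_comm] using this

lemma integral_mul_exp_eq_of_forall_negEntropyDual_le {c₀ : Fin m → ℝ}
    (hmin : ∀ c, negEntropyDual a b γ c₀ ≤ negEntropyDual a b γ c) (d : Fin m → ℝ) :
    ∫ x in a..b, coeffEval d x * exp (coeffEval c₀ x) = ∑ k, d k * γ k := by
  have hF : ∀ t : ℝ, negEntropyDual a b γ (c₀ + t • d) =
      (∫ x in a..b, exp (coeffEval c₀ x + t * coeffEval d x)) -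
        (∑ k, c₀ k * γ k + t * ∑ k, d k * γ k) := by
    intro t
    simp only [negEntropyDual, coeffEval_add, coeffEval_smul]
    simp [add_mul, Finset.sum_add_distrib, Finset.mul_sum, mul_assoc]
  have hderiv : HasDerivAt (fun t : ℝ => negEntropyDual a b γ (c₀ + t • d))
      ((∫ x in a..b, coeffEval d x * exp (coeffEval c₀ x)) - ∑ k, d k * γ k) 0 := by
    simp only [hF]
    refine (hasDerivAt_integral_exp_add_mul
      (continuous_coeffEval _) (continuous_coeffEval _)).sub ?_
    simpa using ((hasDerivAt_id (0 : ℝ)).mul_const (∑ k, d k * γ k)).const_add (∑ k, c₀ k * γ k)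
  refine sub_eq_zero.mp (IsLocalMin.hasDerivAt_eq_zero (.of_forall fun t => ?_) hderiv)
  simpa using hmin (c₀ + t • d)

lemma negEntropyDual_lt_of_moments (hab : a < b) {c₀ c : Fin m → ℝ} (hne : c ≠ c₀)
    (hmom : ∀ d : Fin m → ℝ,
      ∫ x in a..b, coeffEval d x * exp (coeffEval c₀ x) = ∑ k, d k * γ k) :
    negEntropyDual a b γ c₀ < negEntropyDual a b γ c := by
  let g : ℝ → ℝ := fun x =>
    exp (coeffEval c x) - exp (coeffEval c₀ x) - coeffEval (c - c₀) x * exp (coeffEval c₀ x)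
  have hg : ∀ x, g x =
      exp (coeffEval c₀ x) * (exp (coeffEval (c - c₀) x) - (coeffEval (c - c₀) x + 1)) := by
    intro x
    have : coeffEval c x = coeffEval c₀ x + coeffEval (c - c₀) x := by
      rw [← coeffEval_add, add_sub_cancel]
    simp only [g, this, exp_add]
    ring
  obtain ⟨x₀, hx₀, hne₀⟩ : ∃ x ∈ Icc a b, coeffEval (c - c₀) x ≠ 0 := by
    by_contra! h
    exact hne (sub_eq_zero.mp (eq_zero_of_coeffEval_eq_zero_on_Icc hab h))
  have hpos : 0 < ∫ x in a..b, g x := by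
    refine intervalIntegral.integral_pos hab (by fun_prop) (fun x _ => ?_) ⟨x₀, hx₀, ?_⟩
    · rw [hg]
      exact mul_nonneg (exp_pos _).le (sub_nonneg.mpr (add_one_le_exp _))
    · rw [hg]
      exact mul_pos (exp_pos _) (sub_pos.mpr (add_one_lt_exp hne₀))
  have hintegral : ∫ x in a..b, g x = negEntropyDual a b γ c - negEntropyDual a b γ c₀ := by
    simp only [g]
    rw [intervalIntegral.integral_sub (Continuous.intervalIntegrable (by fun_prop) _ _)
        (Continuous.intervalIntegrable (by fun_prop) _ _),
      intervalIntegral.integral_sub (Continuous.intervalIntegrable (by fun_prop) _ _)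
        (Continuous.intervalIntegrable (by fun_prop) _ _), hmom]
    simp only [negEntropyDual, Pi.sub_apply, sub_mul, Finset.sum_sub_distrib]
    ring
  linarith

end negEntropyDual

/-- If `γ` lies in the interior of the cone of truncated moment sequences on a
bounded interval `[a, b]` (i.e. `Σ c_k γ_k > 0` for every nonzero polynomial of
degree at most `n` that is non-negative on `[a, b]`), then the entropy dual
functional `L(λ) = Σ λ_k γ_k − ∫_a^b exp(λ·𝐱) dx` attains its supremum at a
unique point, and the maximizer matches the moments. -/
theorem stmt_7 (a b : ℝ) (hab : a < b) (n : ℕ) (γ : Fin (n + 1) → ℝ)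
    (hγ : ∀ c : Fin (n + 1) → ℝ, c ≠ 0 →
      (∀ x ∈ Icc a b, 0 ≤ ∑ k : Fin (n + 1), c k * x ^ (k : ℕ)) →
      0 < ∑ k : Fin (n + 1), c k * γ k)
    (L : (Fin (n + 1) → ℝ) → ℝ)
    (hL : ∀ lam, L lam = (∑ k : Fin (n + 1), lam k * γ k) -
      ∫ x in a..b, Real.exp (∑ k : Fin (n + 1), lam k * x ^ (k : ℕ))) :
    ∃ lamStar : Fin (n + 1) → ℝ,
      (∀ lam : Fin (n + 1) → ℝ, L lam ≤ L lamStar) ∧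
      (∀ lam' : Fin (n + 1) → ℝ,
        (∀ lam : Fin (n + 1) → ℝ, L lam ≤ L lam') → lam' = lamStar) ∧
      (∀ k : Fin (n + 1),
        γ k = ∫ x in a..b,
          x ^ (k : ℕ) *
            Real.exp (∑ j : Fin (n + 1), lamStar j * x ^ (j : ℕ))) := by
  have hLneg : ∀ c, L c = -negEntropyDual a b γ c := by
    intro c
    rw [hL, negEntropyDual, neg_sub]
    rfl
  obtain ⟨c₀, hmin⟩ := exists_forall_negEntropyDual_le hab hγ
  have hmom := integral_mul_exp_eq_of_forall_negEntropyDual_le hmin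
  refine ⟨c₀, fun c => ?_, fun c hc => ?_, fun k => ?_⟩
  · rw [hLneg, hLneg]
    exact neg_le_neg (hmin c)
  · by_contra hne
    have hle := hc c₀
    rw [hLneg, hLneg] at hle
    linarith [negEntropyDual_lt_of_moments hab hne hmom]
  · have h := hmom (Pi.single k 1)
    simp only [coeffEval_single] at h
    simpa [coeffEval, Pi.single_apply] using h.symm
end

section
/- Let n ≥ 1. Let σ_0, …, σ_{n−1} ∈ ℝ be such that, with Q(x) = Σ_{i=0}^{n−1} σ_i x^i, the integrals ∫_0^∞ x^j e^{Q(x)} dx are finite for 0 ≤ j ≤ n. Let τ_0, …, τ_n ∈ ℝ with τ_n < 0 and set R(x) = Σ_{i=0}^n τ_i x^i. If ∫_0^∞ x^j e^{R(x)} dx = ∫_0^∞ x^j e^{Q(x)} dx for all 0 ≤ j ≤ n−1, then ∫_0^∞ x^n e^{R(x)} dx ≤ ∫_0^∞ x^n e^{Q(x)} dx. In other words, a truncated Stieltjes moment sequence realized by an exponential density of degree n−1 can be extended to a maximum-entropy-realizable sequence of degree n only if the new moment does not exceed γ_n(max) = ∫_0^∞ x^n e^{Q(x)} dx. -/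
open MeasureTheory Set Real

/-- On `(0, ∞)`, integrability of `x ^ n * f x` with `f` continuous implies that of the lower
powers. -/
theorem integrableOn_pow_mul_of_le {f : ℝ → ℝ} (hf : Continuous f) {j n : ℕ} (hjn : j ≤ n)
    (h : IntegrableOn (fun x : ℝ => x ^ n * f x) (Ioi (0 : ℝ))) :
    IntegrableOn (fun x : ℝ => x ^ j * f x) (Ioi (0 : ℝ)) := by
  have hc : Continuous fun x : ℝ => x ^ j * f x := by fun_prop
  rw [← Ioc_union_Ioi_eq_Ioi (zero_le_one' ℝ)]
  refine IntegrableOn.union ((hc.integrableOn_Icc).mono_set Ioc_subset_Icc_self) ?_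
  refine Integrable.mono (h.mono_set (Ioi_subset_Ioi zero_le_one)) hc.aestronglyMeasurable ?_
  refine (ae_restrict_iff' measurableSet_Ioi).2 (ae_of_all _ fun x hx => ?_)
  have hx1 : (1 : ℝ) ≤ x := le_of_lt hx
  rw [norm_mul, norm_mul, norm_pow, norm_pow]
  gcongr
  exact hx1.trans (le_abs_self x)

/-- The exponential is increasing, in product form. -/
theorem sub_mul_exp_sub_exp_nonneg (a b : ℝ) : 0 ≤ (a - b) * (Real.exp a - Real.exp b) := by
  rcases le_total a b with h | h
  · exact mul_nonneg_of_nonpos_of_nonpos (sub_nonpos.2 h) (sub_nonpos.2 (Real.exp_le_exp.2 h))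
  · exact mul_nonneg (sub_nonneg.2 h) (sub_nonneg.2 (Real.exp_le_exp.2 h))

/-- One-step extension bound for maximum-entropy realizable truncated Stieltjes
moment sequences: if an exponential density of degree `n−1` and one of degree
`n` (with negative leading coefficient) have the same moments up to order
`n−1`, then the `n`-th moment of the degree-`n` density does not exceed
`γ_n(max) = ∫_0^∞ x^n e^{Q(x)} dx`. -/
theorem stmt_8 (n : ℕ) (hn : 1 ≤ n) (σ : Fin n → ℝ)
    (Q : ℝ → ℝ) (hQ : ∀ x, Q x = ∑ i : Fin n, σ i * x ^ (i : ℕ))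
    (hQint : ∀ j ≤ n,
      IntegrableOn (fun x : ℝ => x ^ j * Real.exp (Q x)) (Ioi (0 : ℝ)))
    (τ : Fin (n + 1) → ℝ) (hτ : τ ⟨n, Nat.lt_succ_self n⟩ < 0)
    (R : ℝ → ℝ) (hR : ∀ x, R x = ∑ i : Fin (n + 1), τ i * x ^ (i : ℕ))
    (hmatch : ∀ j < n,
      ∫ x in Ioi (0 : ℝ), x ^ j * Real.exp (R x) =
        ∫ x in Ioi (0 : ℝ), x ^ j * Real.exp (Q x)) :
    ∫ x in Ioi (0 : ℝ), x ^ n * Real.exp (R x) ≤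
      ∫ x in Ioi (0 : ℝ), x ^ n * Real.exp (Q x) := by
  by_cases hint : IntegrableOn (fun x : ℝ => x ^ n * Real.exp (R x)) (Ioi (0 : ℝ))
  swap
  · rw [integral_undef hint]
    refine setIntegral_nonneg measurableSet_Ioi fun x hx => ?_
    have hx0 : (0 : ℝ) < x := hx
    positivity
  have hRc : Continuous fun x => Real.exp (R x) := by
    simp only [hR]
    fun_prop
  have hRint (j : ℕ) (hj : j ≤ n) :
      IntegrableOn (fun x : ℝ => x ^ j * Real.exp (R x)) (Ioi (0 : ℝ)) :=
    integrableOn_pow_mul_of_le hRc hj hint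
  have hD (j : ℕ) (hj : j ≤ n) : IntegrableOn
      (fun x : ℝ => x ^ j * Real.exp (R x) - x ^ j * Real.exp (Q x)) (Ioi (0 : ℝ)) :=
    (hRint j hj).sub (hQint j hj)
  have hexpand (x : ℝ) : (R x - Q x) * (Real.exp (R x) - Real.exp (Q x)) =
      (∑ i : Fin n, (τ i.castSucc - σ i) *
        (x ^ (i : ℕ) * Real.exp (R x) - x ^ (i : ℕ) * Real.exp (Q x))) +
      τ (Fin.last n) * (x ^ n * Real.exp (R x) - x ^ n * Real.exp (Q x)) := by
    have hdiff : R x - Q x =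
        (∑ i : Fin n, (τ i.castSucc - σ i) * x ^ (i : ℕ)) + τ (Fin.last n) * x ^ n := by
      rw [hR, hQ, Fin.sum_univ_castSucc]
      simp only [Fin.val_castSucc, Fin.val_last, sub_mul, Finset.sum_sub_distrib]
      ring
    rw [hdiff, add_mul, Finset.sum_mul]
    congr 1
    · exact Finset.sum_congr rfl fun i _ => by ring
    · ring
  have hpos : 0 ≤ ∫ x in Ioi (0 : ℝ), (R x - Q x) * (Real.exp (R x) - Real.exp (Q x)) :=
    integral_nonneg fun x => sub_mul_exp_sub_exp_nonneg _ _
  simp only [hexpand] at hpos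
  rw [integral_add
      (integrable_finsetSum _ fun (i : Fin n) _ => (hD i i.is_lt.le).const_mul _)
      ((hD n le_rfl).const_mul _),
    integral_finsetSum _ fun (i : Fin n) _ => (hD i i.is_lt.le).const_mul _,
    Finset.sum_eq_zero, zero_add, integral_const_mul,
    integral_sub (hRint n le_rfl) (hQint n le_rfl)] at hpos
  · have hτ' : τ (Fin.last n) < 0 := hτ
    exact sub_nonpos.1 (nonpos_of_mul_nonneg_right hpos hτ')
  · intro i _
    rw [integral_const_mul, integral_sub (hRint i i.is_lt.le) (hQint i i.is_lt.le),
      hmatch i i.is_lt, sub_self, mul_zero]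
end

section
/- Let μ be a finite positive Borel measure on ℝ. Then there exists a measurable function φ : ℝ → [0,1] with φ ∈ L¹(ℝ) such that for every z ∈ ℂ with Im z > 0: 1 + 𝒞μ(z) = exp( ∫_ℝ φ(t)/(t − z) dt ). -/
open MeasureTheory Set Complex Filter Topology

lemma ofReal_sub_ne_zero_of_im_pos {z : ℂ} (hz : 0 < z.im) (t : ℝ) : (t : ℂ) - z ≠ 0 := by
  intro h
  have := congrArg Complex.im h
  simp at this
  exact hz.ne' this

lemma norm_inv_ofReal_sub_le {z : ℂ} (hz : 0 < z.im) (t : ℝ) :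
    ‖((t : ℂ) - z)⁻¹‖ ≤ z.im⁻¹ := by
  rw [norm_inv]
  refine inv_anti₀ hz ?_
  have := Complex.abs_im_le_norm ((t : ℂ) - z)
  simpa [abs_of_pos hz] using this

lemma continuous_inv_ofReal_sub {z : ℂ} (hz : 0 < z.im) :
    Continuous fun t : ℝ => ((t : ℂ) - z)⁻¹ :=
  (by fun_prop : Continuous fun t : ℝ => (t : ℂ) - z).inv₀ (ofReal_sub_ne_zero_of_im_pos hz)

lemma integrable_ofReal_div_sub {φ : ℝ → ℝ} (hφ : Integrable φ) {z : ℂ} (hz : 0 < z.im) :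
    Integrable fun t : ℝ => (φ t : ℂ) / ((t : ℂ) - z) := by
  simp only [div_eq_mul_inv]
  exact hφ.ofReal.mul_bdd (c := z.im⁻¹) (continuous_inv_ofReal_sub hz).aestronglyMeasurable
    (ae_of_all _ (norm_inv_ofReal_sub_le hz))

lemma exp_integral_indicator_Ioc_div_sub {a b : ℝ} (hab : a ≤ b) {z : ℂ} (hz : 0 < z.im) :
    Complex.exp (∫ t : ℝ, (((Ioc a b).indicator (fun _ => (1 : ℝ)) t : ℝ) : ℂ) / ((t : ℂ) - z)) =
      ((b : ℂ) - z) / ((a : ℂ) - z) := by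
  have hfun : (fun t : ℝ => (((Ioc a b).indicator (fun _ => (1 : ℝ)) t : ℝ) : ℂ) / ((t : ℂ) - z)) =
      (Ioc a b).indicator fun t : ℝ => ((t : ℂ) - z)⁻¹ := by
    ext t
    by_cases ht : t ∈ Ioc a b <;> simp [ht]
  rw [hfun, integral_indicator measurableSet_Ioc, ← intervalIntegral.integral_of_le hab,
    intervalIntegral.integral_eq_sub_of_hasDerivAt
      (f := fun t : ℝ => Complex.log ((t : ℂ) - z)) _
      ((continuous_inv_ofReal_sub hz).intervalIntegrable _ _),
    Complex.exp_sub, Complex.exp_log (ofReal_sub_ne_zero_of_im_pos hz _),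
    Complex.exp_log (ofReal_sub_ne_zero_of_im_pos hz _)]
  intro t _
  have h1 : HasDerivAt (fun t : ℝ => (t : ℂ) - z) 1 t := (Complex.ofRealCLM.hasDerivAt).sub_const z
  have h2 := h1.clog_real (Or.inr (by simpa using hz.ne'))
  simpa using h2

lemma memLp_two_inv_ofReal_sub {z : ℂ} (hz : 0 < z.im) :
    MemLp (fun t : ℝ => ((t : ℂ) - z)⁻¹) 2 := by
  rw [memLp_two_iff_integrable_sq_norm (continuous_inv_ofReal_sub hz).aestronglyMeasurable]
  have h := ((integrable_inv_one_add_sq.comp_div hz.ne').comp_sub_right z.re).const_mul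
    (z.im ^ 2)⁻¹
  refine h.congr (ae_of_all _ fun t => ?_)
  have h2 : ‖(t : ℂ) - z‖ ^ 2 = (t - z.re) ^ 2 + z.im ^ 2 := by
    rw [← Complex.normSq_eq_norm_sq, Complex.normSq_apply]
    simp; ring
  simp only [norm_inv, inv_pow, h2]
  rw [← mul_inv]
  congr 1
  field_simp
  ring

/-- The finite atomic case: the zeros and poles of `1 + ∑ m x / (x - z)` interlace. -/
lemma exists_phase_of_finset (s : Finset ℝ) :
    ∀ m : ℝ → ℝ, (∀ x ∈ s, 0 ≤ m x) → ∀ b : ℝ, (∀ x ∈ s, x < b) →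
      0 ≤ 1 + ∑ x ∈ s, m x / (x - b) →
      ∃ φ : ℝ → ℝ, Measurable φ ∧ (∀ t, φ t ∈ Icc (0 : ℝ) 1) ∧ (∀ t, b < t → φ t = 0) ∧
        Integrable φ ∧ ∫ t, φ t = ∑ x ∈ s, m x ∧
        ∀ z : ℂ, 0 < z.im →
          1 + ∑ x ∈ s, (m x : ℂ) / ((x : ℂ) - z) =
            Complex.exp (∫ t : ℝ, (φ t : ℂ) / ((t : ℂ) - z)) := by
  induction s using Finset.induction_on_max with
  | empty =>
    intro m _ b _ _
    exact ⟨fun _ => 0, measurable_const, by simp, by simp, by simp, by simp, by simp⟩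
  | insert a s has ih =>
    intro m hm b hb hpos
    have ha : a ∉ s := fun h => lt_irrefl _ (has a h)
    have hab : a < b := hb a (Finset.mem_insert_self _ _)
    have hm' : ∀ x ∈ s, 0 ≤ m x := fun x hx => hm x (Finset.mem_insert_of_mem hx)
    have hma : 0 ≤ m a := hm a (Finset.mem_insert_self _ _)
    simp only [Finset.sum_insert ha] at hpos ⊢
    rcases hma.eq_or_lt with h0 | hma
    · simp only [← h0, zero_div, zero_add, Complex.ofReal_zero] at hpos ⊢
      exact ih m hm' b (fun x hx => hb x (Finset.mem_insert_of_mem hx)) hpos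
    obtain ⟨c, ⟨hac, hcb⟩, hc⟩ : ∃ c ∈ Icc a b,
        (c - a) * (1 + ∑ x ∈ s, m x / (x - c)) - m a = 0 := by
      have hcont : ContinuousOn
          (fun c => (c - a) * (1 + ∑ x ∈ s, m x / (x - c)) - m a) (Icc a b) := by
        refine ContinuousOn.sub (ContinuousOn.mul (by fun_prop) (continuousOn_const.add
          (continuousOn_finsetSum _ fun x hx => ContinuousOn.div (by fun_prop) (by fun_prop)
            fun c hc => ?_))) continuousOn_const
        have := has x hx
        have := hc.1
        exact (by linarith : x - c < 0).ne
      have := intermediate_value_Icc hab.le hcont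
      refine this ⟨by simp [hma.le], ?_⟩
      have hba : 0 < b - a := sub_pos.2 hab
      have h1 : m a / (a - b) = - (m a / (b - a)) := by rw [← neg_sub b a, div_neg]
      have h2 : (b - a) * (m a / (b - a)) = m a := by field_simp
      have h3 := mul_nonneg hba.le hpos
      rw [h1] at h3
      linarith
    have hac' : a < c := by
      refine lt_of_le_of_ne hac fun h => ?_
      rw [h] at hc
      simp at hc
      rw [h] at hma
      exact hma.ne' hc
    have hca : 0 < c - a := sub_pos.2 hac'
    have hxc : ∀ x ∈ s, 0 < c - x := fun x hx => by linarith [has x hx]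
    have hxa : ∀ x ∈ s, 0 < a - x := fun x hx => by linarith [has x hx]
    have hroot : 1 + ∑ x ∈ s, m x / (x - c) = m a / (c - a) := by
      rw [eq_div_iff hca.ne']; linarith
    set m' : ℝ → ℝ := fun x => m x * (a - x) / (c - x) with hm'def
    obtain ⟨φ, hφm, hφ01, hφ0, hφi, hφs, hφe⟩ := ih m'
      (fun x hx => div_nonneg (mul_nonneg (hm' x hx) (hxa x hx).le) (hxc x hx).le) a has (by
        have : ∑ x ∈ s, m' x / (x - a) = ∑ x ∈ s, m x / (x - c) := by
          refine Finset.sum_congr rfl fun x hx => ?_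
          have h1 := (hxc x hx).ne'
          have h2 := (hxa x hx).ne'
          have h3 : x - c ≠ 0 := by rw [← neg_sub]; exact neg_ne_zero.2 h1
          have h4 : x - a ≠ 0 := by rw [← neg_sub]; exact neg_ne_zero.2 h2
          simp only [hm'def]
          field_simp
          ring
        rw [this, hroot]
        positivity)
    have hind : Integrable ((Ioc a c).indicator fun _ => (1 : ℝ)) :=
      (integrable_indicator_iff measurableSet_Ioc).2 (by simp)
    refine ⟨fun t => φ t + (Ioc a c).indicator (fun _ => (1 : ℝ)) t,
      hφm.add (measurable_const.indicator measurableSet_Ioc), fun t => ?_, fun t ht => ?_,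
      hφi.add hind, ?_, fun z hz => ?_⟩
    · by_cases ht : t ∈ Ioc a c
      · simp [ht, hφ0 t ht.1]
      · simpa [ht] using hφ01 t
    · have : t ∉ Ioc a c := fun h => by linarith [h.2]
      simp [this, hφ0 t (hab.trans ht)]
    · rw [integral_add hφi hind, hφs, integral_indicator measurableSet_Ioc]
      have h1 : m a = (c - a) + ∑ x ∈ s, (c - a) * (m x / (x - c)) := by
        rw [← Finset.mul_sum]; linarith
      rw [h1]
      have h2 : ∑ x ∈ s, m' x = ∑ x ∈ s, (c - a) * (m x / (x - c)) + ∑ x ∈ s, m x := by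
        rw [← Finset.sum_add_distrib]
        refine Finset.sum_congr rfl fun x hx => ?_
        have h1 := (hxc x hx).ne'
        have h3 : x - c ≠ 0 := by rw [← neg_sub]; exact neg_ne_zero.2 h1
        simp only [hm'def]
        field_simp
        ring
      rw [h2]
      simp [hac]
      ring
    · have haz := ofReal_sub_ne_zero_of_im_pos hz a
      have hcz := ofReal_sub_ne_zero_of_im_pos hz c
      have hsum : (∫ t : ℝ, ((φ t + (Ioc a c).indicator (fun _ => (1 : ℝ)) t : ℝ) : ℂ) /
          ((t : ℂ) - z)) = (∫ t : ℝ, (φ t : ℂ) / ((t : ℂ) - z)) +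
          ∫ t : ℝ, (((Ioc a c).indicator (fun _ => (1 : ℝ)) t : ℝ) : ℂ) / ((t : ℂ) - z) := by
        rw [← integral_add (integrable_ofReal_div_sub hφi hz) (integrable_ofReal_div_sub hind hz)]
        congr 1 with t
        rw [Complex.ofReal_add, add_div]
      rw [hsum, Complex.exp_add, ← hφe z hz, exp_integral_indicator_Ioc_div_sub hac hz]
      have hma' : (m a : ℂ) = ((c : ℂ) - a) * (1 + ∑ x ∈ s, (m x : ℂ) / ((x : ℂ) - c)) := by
        have : m a = (c - a) * (1 + ∑ x ∈ s, m x / (x - c)) := by linarith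
        rw [this]
        push_cast
        rfl
      rw [hma', ← mul_div_assoc, eq_div_iff haz]
      have key : (∑ x ∈ s, (m' x : ℂ) / ((x : ℂ) - z)) * ((c : ℂ) - z) =
          ((c : ℂ) - a) * (∑ x ∈ s, (m x : ℂ) / ((x : ℂ) - c)) +
            (∑ x ∈ s, (m x : ℂ) / ((x : ℂ) - z)) * ((a : ℂ) - z) := by
        rw [Finset.sum_mul, Finset.mul_sum, Finset.sum_mul, ← Finset.sum_add_distrib]
        refine Finset.sum_congr rfl fun x hx => ?_
        have hxz := ofReal_sub_ne_zero_of_im_pos hz x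
        have h1 : (c : ℂ) - x ≠ 0 := by exact_mod_cast (hxc x hx).ne'
        have h3 : (x : ℂ) - c ≠ 0 := by rw [← neg_sub]; exact neg_ne_zero.2 h1
        simp only [hm'def]
        push_cast
        field_simp
        ring
      have h4 : ((c : ℂ) - a) * (1 + ∑ x ∈ s, (m x : ℂ) / ((x : ℂ) - c)) / ((a : ℂ) - z) *
          ((a : ℂ) - z) = ((c : ℂ) - a) * (1 + ∑ x ∈ s, (m x : ℂ) / ((x : ℂ) - c)) :=
        div_mul_cancel₀ _ haz
      linear_combination h4 - key

lemma exists_ultrafilter_tendsto_inner {E : Type*} [NormedAddCommGroup E] [InnerProductSpace ℝ E]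
    [CompleteSpace E] {ι : Type*} (l : Ultrafilter ι) (u : ι → E) (C : ℝ) (hu : ∀ n, ‖u n‖ ≤ C) :
    ∃ v : E, ∀ g : E, Tendsto (fun n => inner ℝ (u n) g) l (𝓝 (inner ℝ v g)) := by
  let T : ι → WeakDual ℝ E := fun n => StrongDual.toWeakDual (InnerProductSpace.toDual ℝ E (u n))
  obtain ⟨w, -, hw⟩ := (WeakDual.isCompact_closedBall (0 : StrongDual ℝ E) C).ultrafilter_le_nhds
    (l.map T) (by
      rw [le_principal_iff]
      refine Ultrafilter.mem_coe.2 (Ultrafilter.mem_map.2 (univ_mem' fun n => ?_))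
      simpa [T] using hu n)
  refine ⟨(InnerProductSpace.toDual ℝ E).symm (WeakDual.toStrongDual w), fun g => ?_⟩
  rw [InnerProductSpace.toDual_symm_apply]
  exact ((WeakDual.eval_continuous g).tendsto w).comp hw

/-- Weak compactness of the functions `ℝ → [0,1]` with bounded integral. -/
lemma exists_ultrafilter_tendsto_integral_mul {ι : Type*} (l : Ultrafilter ι) (u : ι → ℝ → ℝ)
    (M : ℝ) (hum : ∀ n, Measurable (u n)) (hu01 : ∀ n t, u n t ∈ Icc (0 : ℝ) 1)
    (hui : ∀ n, Integrable (u n)) (huM : ∀ n, ∫ t, u n t ≤ M) :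
    ∃ φ : ℝ → ℝ, Measurable φ ∧ (∀ t, φ t ∈ Icc (0 : ℝ) 1) ∧ Integrable φ ∧
      ∀ g : ℝ → ℝ, MemLp g 2 → Tendsto (fun n => ∫ t, u n t * g t) l (𝓝 (∫ t, φ t * g t)) := by
  have hsq : ∀ n, Integrable fun t => u n t * u n t := fun n =>
    (hui n).mul_bdd (c := 1) (hum n).aestronglyMeasurable (ae_of_all _ fun t => by
      rw [Real.norm_eq_abs, abs_of_nonneg (hu01 n t).1]; exact (hu01 n t).2)
  have hL : ∀ n, MemLp (u n) 2 := fun n => by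
    rw [memLp_two_iff_integrable_sq (hum n).aestronglyMeasurable]
    simpa only [sq] using hsq n
  have hinner : ∀ (f : ℝ → ℝ) (hf : MemLp f 2) (v : Lp ℝ 2 (volume : Measure ℝ)),
      inner ℝ v (hf.toLp f) = ∫ t, v t * f t := fun f hf v => by
    rw [L2.inner_def]
    refine integral_congr_ae ?_
    filter_upwards [hf.coeFn_toLp] with t ht
    rw [ht]
    simp [mul_comm]
  obtain ⟨v, hv⟩ := exists_ultrafilter_tendsto_inner l (fun n => (hL n).toLp (u n)) (√M) (fun n => by
    refine Real.le_sqrt_of_sq_le ?_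
    rw [← real_inner_self_eq_norm_sq, hinner]
    calc ∫ t, (hL n).toLp (u n) t * u n t = ∫ t, u n t * u n t := by
          refine integral_congr_ae ?_
          filter_upwards [(hL n).coeFn_toLp] with t ht
          rw [ht]
      _ ≤ ∫ t, u n t := integral_mono (hsq n) (hui n) fun t =>
          mul_le_of_le_one_left (hu01 n t).1 (hu01 n t).2
      _ ≤ M := huM n)
  have hlim : ∀ g : ℝ → ℝ, MemLp g 2 →
      Tendsto (fun n => ∫ t, u n t * g t) l (𝓝 (∫ t, v t * g t)) := fun g hg => by
    have h := hv (hg.toLp g)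
    rw [hinner] at h
    refine h.congr fun n => ?_
    rw [hinner]
    refine integral_congr_ae ?_
    filter_upwards [(hL n).coeFn_toLp] with t ht
    rw [ht]
  have hset : ∀ s : Set ℝ, MeasurableSet s → volume s < ⊤ →
      Tendsto (fun n => ∫ t in s, u n t) l (𝓝 (∫ t in s, v t)) := fun s hs hμ => by
    have h := hlim (s.indicator fun _ => 1) (memLp_indicator_const 2 hs 1 (Or.inr hμ.ne))
    have hmul : ∀ f : ℝ → ℝ, ∫ t, f t * s.indicator (fun _ => 1) t = ∫ t in s, f t := fun f => by
      rw [← integral_indicator hs]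
      congr 1 with t
      by_cases ht : t ∈ s <;> simp [ht]
    simpa only [hmul] using h
  have hvint : ∀ s : Set ℝ, MeasurableSet s → volume s < ⊤ → IntegrableOn v s := fun s _ hμ =>
    integrableOn_Lp_of_measure_ne_top v (by norm_num) hμ.ne
  have h0 : 0 ≤ᵐ[volume] v := ae_nonneg_of_forall_setIntegral_nonneg_of_sigmaFinite hvint
    fun s hs hμ => ge_of_tendsto' (hset s hs hμ) fun n => integral_nonneg fun t => (hu01 n t).1
  have h1 : 0 ≤ᵐ[volume] fun t => 1 - v t :=
    ae_nonneg_of_forall_setIntegral_nonneg_of_sigmaFinite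
      (fun s hs hμ => (integrableOn_const hμ.ne).sub (hvint s hs hμ)) fun s hs hμ => by
        have hc : IntegrableOn (fun _ : ℝ => (1 : ℝ)) s := integrableOn_const hμ.ne
        rw [integral_sub hc (hvint s hs hμ), sub_nonneg]
        exact le_of_tendsto' (hset s hs hμ) fun n =>
          integral_mono (hui n).integrableOn hc fun t => (hu01 n t).2
  have hvi : Integrable v := by
    refine (aecover_Icc (μ := volume) (tendsto_neg_atTop_atBot (G := ℝ))
      tendsto_id).integrable_of_integral_bounded_of_nonneg_ae M
      (fun i => hvint _ measurableSet_Icc (by simp)) h0 (Eventually.of_forall fun i => ?_)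
    refine le_of_tendsto' (hset _ measurableSet_Icc (by simp)) fun n => ?_
    exact (setIntegral_le_integral (hui n) (ae_of_all _ fun t => (hu01 n t).1)).trans (huM n)
  have hae : (fun t => max 0 (min 1 (v t))) =ᵐ[volume] v := by
    filter_upwards [h0, h1] with t ht0 ht1
    rw [min_eq_right (sub_nonneg.1 ht1)]
    exact max_eq_right ht0
  refine ⟨fun t => max 0 (min 1 (v t)),
    measurable_const.max (measurable_const.min (Lp.stronglyMeasurable v).measurable),
    fun t => ⟨le_max_left _ _, max_le zero_le_one (min_le_left _ _)⟩, hvi.congr hae.symm,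
    fun g hg => ?_⟩
  have : ∫ t, max 0 (min 1 (v t)) * g t = ∫ t, v t * g t :=
    integral_congr_ae (by filter_upwards [hae] with t ht; rw [ht])
  rw [this]
  exact hlim g hg

lemma simpleFunc_integral_comp_eq_sum {μ : Measure ℝ} [IsFiniteMeasure μ] (s : SimpleFunc ℝ ℝ)
    (f : ℝ → ℂ) :
    ∫ x, f (s x) ∂μ = ∑ y ∈ s.range, (μ.real (s ⁻¹' {y}) : ℂ) * f y := by
  have h : (fun x => f (s x)) = fun x => ∑ y ∈ s.range, (s ⁻¹' {y}).indicator (fun _ => f y) x := by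
    ext x
    rw [Finset.sum_eq_single_of_mem (s x) (s.mem_range_self x)]
    · simp
    · intro y _ hy
      simp [hy.symm]
  rw [h, integral_finsetSum]
  · refine Finset.sum_congr rfl fun y _ => ?_
    rw [integral_indicator_const _ (s.measurableSet_fiber y), Complex.real_smul]
  · intro y _
    exact (integrable_const _).indicator (s.measurableSet_fiber y)

lemma exists_phase_of_simpleFunc (μ : Measure ℝ) [IsFiniteMeasure μ] (s : SimpleFunc ℝ ℝ) :
    ∃ φ : ℝ → ℝ, Measurable φ ∧ (∀ t, φ t ∈ Icc (0 : ℝ) 1) ∧ Integrable φ ∧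
      ∫ t, φ t = μ.real univ ∧
      ∀ z : ℂ, 0 < z.im →
        1 + ∫ x, ((s x : ℂ) - z)⁻¹ ∂μ =
          Complex.exp (∫ t : ℝ, (φ t : ℂ) / ((t : ℂ) - z)) := by
  set m : ℝ → ℝ := fun y => μ.real (s ⁻¹' {y}) with hm
  have hsum : ∑ y ∈ s.range, m y = μ.real univ := by
    have h := simpleFunc_integral_comp_eq_sum (μ := μ) s fun _ => 1
    simp only [integral_const, Complex.real_smul, mul_one] at h
    exact_mod_cast h.symm
  obtain ⟨B, hB⟩ := s.range.bddAbove
  have hM : 0 ≤ μ.real univ := measureReal_nonneg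
  obtain ⟨φ, h1, h2, -, h3, h4, h5⟩ := exists_phase_of_finset s.range m
    (fun _ _ => measureReal_nonneg) (B + μ.real univ + 1)
    (fun x hx => by have := hB hx; linarith) (by
      have hle : ∀ x ∈ s.range, - (m x / (μ.real univ + 1)) ≤
          m x / (x - (B + μ.real univ + 1)) := fun x hx => by
        have hx : x ≤ B := hB hx
        rw [← neg_sub _ x, div_neg, neg_le_neg_iff]
        exact div_le_div_of_nonneg_left measureReal_nonneg (by linarith) (by linarith)
      have := Finset.sum_le_sum hle
      rw [Finset.sum_neg_distrib, ← Finset.sum_div, hsum] at this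
      have h6 : μ.real univ / (μ.real univ + 1) ≤ 1 := div_le_one_of_le₀ (by linarith) (by linarith)
      linarith)
  refine ⟨φ, h1, h2, h3, h4.trans hsum, fun z hz => ?_⟩
  rw [← h5 z hz, simpleFunc_integral_comp_eq_sum s fun y => ((y : ℂ) - z)⁻¹]
  simp only [div_eq_mul_inv, hm]

lemma tendsto_integral_ofReal_div_sub {ι : Type*} {l : Filter ι} {u : ι → ℝ → ℝ} {φ : ℝ → ℝ}
    (hui : ∀ n, Integrable (u n)) (hφ : Integrable φ)
    (h : ∀ g : ℝ → ℝ, MemLp g 2 →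
      Tendsto (fun n => ∫ t, u n t * g t) l (𝓝 (∫ t, φ t * g t)))
    {z : ℂ} (hz : 0 < z.im) :
    Tendsto (fun n => ∫ t, (u n t : ℂ) / ((t : ℂ) - z)) l
      (𝓝 (∫ t, (φ t : ℂ) / ((t : ℂ) - z))) := by
  have hmem := memLp_two_inv_ofReal_sub hz
  have hsplit : ∀ f : ℝ → ℝ, Integrable f → ∫ t, (f t : ℂ) / ((t : ℂ) - z) =
      ((∫ t, f t * (((t : ℂ) - z)⁻¹).re : ℝ) : ℂ) +
        ((∫ t, f t * (((t : ℂ) - z)⁻¹).im : ℝ) : ℂ) * I := fun f hf => by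
    have := integral_re_add_im (integrable_ofReal_div_sub hf hz)
    rw [← this]
    simp only [div_eq_mul_inv, RCLike.re_to_complex, RCLike.im_to_complex, Complex.re_ofReal_mul,
      Complex.im_ofReal_mul]
    rfl
  rw [hsplit φ hφ]
  simp_rw [fun n => hsplit (u n) (hui n)]
  exact ((Complex.continuous_ofReal.tendsto _).comp (h _ hmem.re)).add
    (((Complex.continuous_ofReal.tendsto _).comp (h _ hmem.im)).mul_const I)

/-- Phase regularization of a finite positive Borel measure on `ℝ`
(A. A. Markov / Aronszajn–Donoghue): there is a measurable `φ : ℝ → [0,1]`,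
`φ ∈ L¹(ℝ)`, with `1 + 𝒞μ(z) = exp(∫ φ(t)/(t − z) dt)` on the upper
half-plane. -/
theorem stmt_10 (μ : Measure ℝ) [IsFiniteMeasure μ] :
    ∃ φ : ℝ → ℝ, Measurable φ ∧ (∀ t, φ t ∈ Icc (0 : ℝ) 1) ∧
      Integrable φ ∧
      ∀ z : ℂ, 0 < z.im →
        1 + ∫ x : ℝ, ((x : ℂ) - z)⁻¹ ∂μ =
          Complex.exp (∫ t : ℝ, (φ t : ℂ) / ((t : ℂ) - z)) := by
  let s : ℕ → SimpleFunc ℝ ℝ := SimpleFunc.approxOn id measurable_id univ 0 (mem_univ _)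
  have hs : ∀ x, Tendsto (fun n => s n x) atTop (𝓝 x) := fun x =>
    SimpleFunc.tendsto_approxOn measurable_id (mem_univ _) (by simp)
  choose u hum hu01 hui hu1 hue using fun n => exists_phase_of_simpleFunc μ (s n)
  obtain ⟨φ, hφm, hφ01, hφi, hφ⟩ := exists_ultrafilter_tendsto_integral_mul (hyperfilter ℕ) u
    (μ.real univ) hum hu01 hui fun n => (hu1 n).le
  refine ⟨φ, hφm, hφ01, hφi, fun z hz => ?_⟩
  have hR := (Complex.continuous_exp.tendsto _).comp (tendsto_integral_ofReal_div_sub hui hφi hφ hz)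
  have hL : Tendsto (fun n => ∫ x, ((s n x : ℂ) - z)⁻¹ ∂μ) atTop
      (𝓝 (∫ x : ℝ, ((x : ℂ) - z)⁻¹ ∂μ)) :=
    tendsto_integral_of_dominated_convergence (fun _ => z.im⁻¹)
      (fun n => ((continuous_inv_ofReal_sub hz).measurable.comp
        (s n).measurable).aestronglyMeasurable)
      (integrable_const _) (fun n => ae_of_all _ fun x => norm_inv_ofReal_sub_le hz _)
      (ae_of_all _ fun x => ((continuous_inv_ofReal_sub hz).tendsto x).comp (hs x))
  have hle : ((hyperfilter ℕ : Ultrafilter ℕ) : Filter ℕ) ≤ atTop :=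
    Nat.hyperfilter_le_atTop
  refine tendsto_nhds_unique ((hL.mono_left hle).const_add 1) (hR.congr fun n => ?_)
  exact (hue n z hz).symm
end
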